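/- Let k ≥ 2 and d ≥ 1 be integers, and let A_1, …, A_k be invertible d×d complex matrices satisfying the ellipticity condition. Write d_m = dim P_m = d·binom(m+k−1, m) and h_m = dim H_m, where H_m = P_m ∩ ker Δ. Then h_m = d_m − d_{m−2} for m ≥ 2, and h_m = d_m for m = 0 and m = 1. -/

import Mathlib

open MvPolynomial Matrix

noncomputable section

abbrev VPoly (k d : ℕ) := Fin d → MvPolynomial (Fin k) ℂ

def IsHomV {k d : ℕ} (m : ℕ) (p : VPoly k d) : Prop := ∀ r, (p r).IsHomogeneous m

def elliptic {k d : ℕ} (A : Fin k → Matrix (Fin d) (Fin d) ℂ) : Prop :=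
  ∀ c : Fin k → ℝ, (∑ j, (c j : ℂ) • A j).det = 0 → c = 0

def DeltaOp {k d : ℕ} (A : Fin k → Matrix (Fin d) (Fin d) ℂ) :
    VPoly k d →ₗ[ℂ] VPoly k d :=
  LinearMap.pi fun r =>
    - ∑ i, ∑ j, ∑ s, ((A i)ᴴ * A j) r s •
        ((pderiv i).toLinearMap ∘ₗ (pderiv j).toLinearMap ∘ₗ LinearMap.proj s)

def BOp {k d : ℕ} (A : Fin k → Matrix (Fin d) (Fin d) ℂ) :
    VPoly k d →ₗ[ℂ] VPoly k d :=
  LinearMap.pi fun r =>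
    - ∑ i, ∑ j, ∑ s, ((A i)ᴴ * A j) r s •
        ((LinearMap.mulLeft ℂ (X i * X j)) ∘ₗ LinearMap.proj s)

def LOp {k d : ℕ} (A : Fin k → Matrix (Fin d) (Fin d) ℂ) :
    VPoly k d →ₗ[ℂ] VPoly k d :=
  LinearMap.pi fun r =>
    (∑ j, ∑ l, ∑ s, ((A l)ᴴ * A j) r s •
        ((LinearMap.mulLeft ℂ (X l)) ∘ₗ (pderiv j).toLinearMap ∘ₗ LinearMap.proj s))
    - ∑ j, (LinearMap.mulLeft ℂ (X j)) ∘ₗ (pderiv j).toLinearMap ∘ₗ LinearMap.proj r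

def PmSub (k d m : ℕ) : Submodule ℂ (VPoly k d) :=
  Submodule.pi Set.univ fun _ : Fin d => homogeneousSubmodule (Fin k) ℂ m

def HmSub {k d : ℕ} (A : Fin k → Matrix (Fin d) (Fin d) ℂ) (m : ℕ) :
    Submodule ℂ (VPoly k d) :=
  PmSub k d m ⊓ LinearMap.ker (DeltaOp A)

def fischer {k d : ℕ} (p q : VPoly k d) : ℂ :=
  ∑ r, ∑ α ∈ (p r).support,
    (∏ i, (Nat.factorial (α i) : ℂ)) * coeff α (p r) * (starRingEnd ℂ) (coeff α (q r))

/-- The exponential generating series of a functional on polynomials. -/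
def dualSeries (σ : Type*) : Module.Dual ℂ (MvPolynomial σ ℂ) →ₗ[ℂ] MvPowerSeries σ ℂ where
  toFun g := fun α => g (monomial α 1) / (α.prod fun _ n => (n.factorial : ℂ))
  map_add' _ _ := funext fun _ => add_div _ _ _
  map_smul' _ _ := funext fun _ => mul_div_assoc _ _ _

lemma coeff_dualSeries {σ : Type*} (g : Module.Dual ℂ (MvPolynomial σ ℂ)) (α : σ →₀ ℕ) :
    MvPowerSeries.coeff α (dualSeries σ g)
      = g (monomial α 1) / (α.prod fun _ n => (n.factorial : ℂ)) := rfl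

lemma finsupp_prod_factorial_ne_zero {σ : Type*} (α : σ →₀ ℕ) :
    (α.prod fun _ n => (n.factorial : ℂ)) ≠ 0 :=
  Finset.prod_ne_zero_iff.2 fun _ _ => Nat.cast_ne_zero.2 (Nat.factorial_ne_zero _)

lemma dualSeries_injective (σ : Type*) : Function.Injective (dualSeries σ) := by
  rw [injective_iff_map_eq_zero]
  intro g hg
  ext α
  have h : MvPowerSeries.coeff α (dualSeries σ g) = 0 := by rw [hg, map_zero]
  rw [coeff_dualSeries, div_eq_zero_iff] at h
  exact h.resolve_right (finsupp_prod_factorial_ne_zero α)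

/-- Precomposing a functional with `∂ᵢ` multiplies its generating series by `Xᵢ`. -/
lemma dualSeries_comp_pderiv {σ : Type*} (g : Module.Dual ℂ (MvPolynomial σ ℂ)) (i : σ) :
    dualSeries σ (g ∘ₗ (pderiv i).toLinearMap) = MvPowerSeries.X i * dualSeries σ g := by
  classical
  ext α
  rw [coeff_dualSeries, MvPowerSeries.X, MvPowerSeries.coeff_monomial_mul, coeff_dualSeries]
  simp only [LinearMap.comp_apply, Derivation.coeFn_coe,
    pderiv_monomial, one_mul, Finsupp.single_le_iff]
  split_ifs with h
  · obtain ⟨β, rfl⟩ : ∃ β, α = β + Finsupp.single i 1 :=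
      ⟨α - Finsupp.single i 1, (tsub_add_cancel_of_le (Finsupp.single_le_iff.2 h)).symm⟩
    have hfac : ((β + Finsupp.single i 1).prod fun _ n => (n.factorial : ℂ))
        = (β i + 1 : ℂ) * β.prod fun _ n => (n.factorial : ℂ) := by
      have key (γ : σ →₀ ℕ) : (γ.prod fun _ n => (n.factorial : ℂ))
          = (γ i).factorial * (γ.erase i).prod fun _ n => (n.factorial : ℂ) :=
        (Finsupp.mul_prod_erase' γ i (fun _ n => (n.factorial : ℂ)) (by simp)).symm
      rw [key, key β, ← mul_assoc]
      simp [Finsupp.erase_add, Nat.factorial_succ]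
    have hm (c : ℂ) : monomial β c = c • monomial β (1 : ℂ) := by
      rw [smul_monomial, smul_eq_mul, mul_one]
    have h0 := finsupp_prod_factorial_ne_zero β
    have h1 : (β i + 1 : ℂ) ≠ 0 := Nat.cast_add_one_ne_zero _
    rw [add_tsub_cancel_right, hm, map_smul, hfac]
    simp only [Finsupp.add_apply, Finsupp.single_eq_same, smul_eq_mul, Nat.cast_add, Nat.cast_one]
    field_simp
  · have : α i = 0 := by omega
    simp [this]

/-- The symbol `∑ Aᵢᴴ Aⱼ Xᵢ Xⱼ`, as a matrix of polynomials. -/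
def symbolMatrix {k d : ℕ} (A : Fin k → Matrix (Fin d) (Fin d) ℂ) :
    Matrix (Fin d) (Fin d) (MvPolynomial (Fin k) ℂ) :=
  ∑ i, ∑ j, (X i * X j : MvPolynomial (Fin k) ℂ) • ((A i)ᴴ * A j).map C

lemma det_symbolMatrix_ne_zero {k d : ℕ} (A : Fin k → Matrix (Fin d) (Fin d) ℂ) (j₀ : Fin k)
    (h : IsUnit (A j₀)) : (symbolMatrix A).det ≠ 0 := by
  intro h0
  have h1 := congrArg (eval (Pi.single j₀ (1 : ℂ))) h0
  rw [RingHom.map_det, map_zero] at h1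
  have h2 : (eval (Pi.single j₀ (1 : ℂ))).mapMatrix (symbolMatrix A) = (A j₀)ᴴ * A j₀ := by
    ext r s
    simp [symbolMatrix, Matrix.sum_apply, Pi.single_apply, Matrix.mul_apply]
  rw [h2, det_mul, det_conjTranspose, mul_eq_zero, star_eq_zero, or_self] at h1
  exact ((Matrix.isUnit_iff_isUnit_det _).1 h).ne_zero h1

lemma DeltaOp_apply {k d : ℕ} (A : Fin k → Matrix (Fin d) (Fin d) ℂ) (p : VPoly k d) (r : Fin d) :
    DeltaOp A p r = - ∑ i, ∑ j, ∑ s, ((A i)ᴴ * A j) r s • pderiv i (pderiv j (p s)) := by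
  simp [DeltaOp]

lemma DeltaOp_surjective {k d : ℕ} (A : Fin k → Matrix (Fin d) (Fin d) ℂ) (j₀ : Fin k)
    (h : IsUnit (A j₀)) : Function.Surjective (DeltaOp A) := by
  rw [← LinearMap.range_eq_top]
  by_contra hne
  obtain ⟨f, hf0, hf⟩ := Submodule.exists_le_ker_of_lt_top _ (lt_top_iff_ne_top.2 hne)
  apply hf0
  let q : Fin d → MvPowerSeries (Fin k) ℂ := fun r =>
    dualSeries _ (f ∘ₗ LinearMap.single ℂ (fun _ => MvPolynomial (Fin k) ℂ) r)
  let N := coeToMvPowerSeries.ringHom.mapMatrix (symbolMatrix A)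
  have hN : N.det ≠ 0 := by
    rw [← RingHom.map_det]
    exact (map_ne_zero_iff _ (MvPolynomial.coe_injective _ _)).2 (det_symbolMatrix_ne_zero A j₀ h)
  have hq : q ᵥ* N = 0 := by
    funext s
    have hzero : (∑ i, ∑ j, ∑ r, ((A i)ᴴ * A j) r s •
        ((f ∘ₗ LinearMap.single ℂ (fun _ => MvPolynomial (Fin k) ℂ) r) ∘ₗ
          (pderiv i).toLinearMap) ∘ₗ (pderiv j).toLinearMap) = 0 := by
      refine LinearMap.ext fun p => ?_
      have h1 : f (DeltaOp A (Pi.single s p)) = 0 := hf ⟨_, rfl⟩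
      have h2 : DeltaOp A (Pi.single s p) = - ∑ i, ∑ j, ∑ r, ((A i)ᴴ * A j) r s •
          Pi.single r (pderiv i (pderiv j p)) := by
        funext r
        rw [DeltaOp_apply]
        simp only [Pi.neg_apply, Finset.sum_apply, Pi.smul_apply]
        congr 1
        refine Finset.sum_congr rfl fun i _ => Finset.sum_congr rfl fun j _ => ?_
        rw [Finset.sum_eq_single s, Finset.sum_eq_single r]
        · simp
        · intro b _ hb; simp [hb.symm]
        · simp
        · intro b _ hb; simp [hb]
        · simp
      rw [h2, map_neg, neg_eq_zero] at h1
      simpa [map_sum] using h1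
    have hS := congrArg (dualSeries (Fin k)) hzero
    simp only [map_sum, map_smul, dualSeries_comp_pderiv, map_zero] at hS
    rw [Pi.zero_apply, ← hS, Matrix.vecMul, dotProduct]
    have hNrs (r : Fin d) : N r s = ∑ i, ∑ j, ((A i)ᴴ * A j) r s •
        (MvPowerSeries.X j * MvPowerSeries.X i : MvPowerSeries (Fin k) ℂ) := by
      simp only [N, symbolMatrix, RingHom.mapMatrix_apply, Matrix.map_apply, Matrix.sum_apply,
        Matrix.smul_apply, map_sum, smul_eq_mul, map_mul, coeToMvPowerSeries.ringHom_apply,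
        MvPolynomial.coe_X, MvPolynomial.coe_C, MvPowerSeries.smul_eq_C_mul]
      exact Finset.sum_congr rfl fun i _ => Finset.sum_congr rfl fun j _ => by ring
    simp only [hNrs, Finset.mul_sum]
    rw [Finset.sum_comm]
    refine Finset.sum_congr rfl fun i _ => ?_
    rw [Finset.sum_comm]
    refine Finset.sum_congr rfl fun j _ => Finset.sum_congr rfl fun r _ => ?_
    rw [mul_smul_comm, mul_comm (q r), mul_assoc]
  have hq0 : q = 0 := Matrix.eq_zero_of_vecMul_eq_zero hN hq
  refine LinearMap.pi_ext' fun r => ?_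
  exact dualSeries_injective _ ((congrFun hq0 r).trans (map_zero _).symm)

lemma pderiv_homogeneousComponent {σ R : Type*} [CommSemiring R] (n : ℕ) (i : σ)
    (p : MvPolynomial σ R) :
    pderiv i (homogeneousComponent (n + 1) p) = homogeneousComponent n (pderiv i p) := by
  classical
  induction p using MvPolynomial.induction_on' with
  | monomial α a =>
    have hα : (monomial α a).IsHomogeneous α.degree := isHomogeneous_monomial _ rfl
    rw [homogeneousComponent_of_mem hα, homogeneousComponent_of_mem hα.pderiv]
    rcases Nat.eq_zero_or_pos α.degree with h | h
    · rw [Finsupp.degree_eq_zero_iff] at h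
      subst h
      simp
    · have : n + 1 = α.degree ↔ n = α.degree - 1 := by omega
      simp only [this]
      split_ifs <;> simp
  | add p q hp hq => simp only [map_add, hp, hq]

lemma mem_PmSub {k d m : ℕ} {p : VPoly k d} : p ∈ PmSub k d m ↔ IsHomV m p := by
  simp [PmSub, IsHomV, Submodule.mem_pi]

lemma map_DeltaOp_PmSub {k d : ℕ} (A : Fin k → Matrix (Fin d) (Fin d) ℂ) (j₀ : Fin k)
    (h : IsUnit (A j₀)) (m : ℕ) :
    (PmSub k d (m + 2)).map (DeltaOp A) = PmSub k d m := by
  apply le_antisymm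
  · rintro _ ⟨p, hp, rfl⟩
    rw [SetLike.mem_coe, mem_PmSub] at hp
    rw [mem_PmSub]
    intro r
    rw [DeltaOp_apply]
    refine Submodule.neg_mem (homogeneousSubmodule (Fin k) ℂ m) ?_
    exact Submodule.sum_mem _ fun i _ => Submodule.sum_mem _ fun j _ => Submodule.sum_mem _
      fun s _ => Submodule.smul_mem _ _ (hp s).pderiv.pderiv
  · intro q hq
    rw [mem_PmSub] at hq
    obtain ⟨p, rfl⟩ := DeltaOp_surjective A j₀ h q
    refine ⟨fun r => homogeneousComponent (m + 2) (p r),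
      mem_PmSub.2 fun r => homogeneousComponent_isHomogeneous _ _, ?_⟩
    funext r
    rw [← homogeneousComponent_eq_self (hq r), DeltaOp_apply, DeltaOp_apply]
    simp only [map_neg, map_sum, map_smul, pderiv_homogeneousComponent]

lemma HmSub_eq_PmSub {k d : ℕ} (A : Fin k → Matrix (Fin d) (Fin d) ℂ) {m : ℕ} (hm : m ≤ 1) :
    HmSub A m = PmSub k d m := by
  refine inf_eq_left.2 fun p hp => ?_
  rw [mem_PmSub] at hp
  rw [LinearMap.mem_ker]
  funext r
  have hpd (i j : Fin k) (s : Fin d) : pderiv i (pderiv j (p s)) = 0 := by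
    have h0 : (pderiv j (p s)).IsHomogeneous 0 := by
      simpa [Nat.sub_eq_zero_of_le hm] using (hp s).pderiv (i := j)
    rw [← totalDegree_zero_iff_isHomogeneous] at h0
    rw [totalDegree_eq_zero_iff_eq_C.1 h0, pderiv_C]
  simp [DeltaOp_apply, hpd]

lemma finrank_homogeneousSubmodule (σ R : Type*) [Fintype σ] [CommRing R] [Nontrivial R] (m : ℕ) :
    Module.finrank R (homogeneousSubmodule σ R m) = (Fintype.card σ + m - 1).choose m := by
  classical
  let e : Sym σ m ≃ {α : σ →₀ ℕ | α.degree = m} :=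
    (Sym.equivNatSum σ m).trans (Equiv.subtypeEquivRight fun _ => Iff.rfl)
  rw [homogeneousSubmodule_eq_finsupp_supported,
    (AddMonoidAlgebra.supportedEquivFinsupp _).finrank_eq,
    (Finsupp.domLCongr e.symm).finrank_eq, Module.finrank_finsupp_self,
    Sym.card_sym_eq_choose]

/-- `PmSub` as a power of the space of scalar homogeneous polynomials. -/
def PmSubEquiv (k d m : ℕ) : PmSub k d m ≃ₗ[ℂ] (Fin d → homogeneousSubmodule (Fin k) ℂ m) where
  toFun p r := ⟨p.1 r, p.2 r trivial⟩
  invFun p := ⟨fun r => (p r).1, fun r _ => (p r).2⟩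
  map_add' _ _ := rfl
  map_smul' _ _ := rfl

instance homogeneousSubmodule_finite (σ R : Type*) [Finite σ] [CommSemiring R] (m : ℕ) :
    Module.Finite R (homogeneousSubmodule σ R m) :=
  Module.Finite.iff_fg.2 (homogeneousSubmodule_fg _ _ m)

instance PmSub_finite (k d m : ℕ) : Module.Finite ℂ (PmSub k d m) :=
  Module.Finite.equiv (PmSubEquiv k d m).symm

lemma finrank_PmSub (k d m : ℕ) :
    Module.finrank ℂ (PmSub k d m) = d * Nat.choose (m + k - 1) m := by
  rw [(PmSubEquiv k d m).finrank_eq, Module.finrank_pi_fintype]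
  simp [finrank_homogeneousSubmodule, add_comm]

lemma finrank_HmSub_add {k d : ℕ} (A : Fin k → Matrix (Fin d) (Fin d) ℂ) (j₀ : Fin k)
    (h : IsUnit (A j₀)) (m : ℕ) :
    Module.finrank ℂ (PmSub k d m) + Module.finrank ℂ (HmSub A (m + 2))
      = Module.finrank ℂ (PmSub k d (m + 2)) := by
  have hrn := LinearMap.finrank_range_add_finrank_ker ((DeltaOp A).domRestrict (PmSub k d (m + 2)))
  rw [LinearMap.range_domRestrict, map_DeltaOp_PmSub A j₀ h, LinearMap.ker_domRestrict] at hrn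
  rw [← hrn, HmSub, ← Submodule.map_comap_subtype, LinearEquiv.finrank_eq
    (Submodule.equivMapOfInjective _ (Submodule.injective_subtype _) _)]

/-- With `d_m = dim P_m = d·binom(m+k−1, m)` and `h_m = dim H_m`,
one has `h_m = d_m − d_{m−2}` for `m ≥ 2` and `h_m = d_m` for `m = 0, 1`. -/
theorem dim_harmonic_polynomials (k d : ℕ) (hk : 2 ≤ k) (hd : 1 ≤ d)
    (A : Fin k → Matrix (Fin d) (Fin d) ℂ)
    (hinv : ∀ j, IsUnit (A j))
    (hell : elliptic A) :
    (∀ m : ℕ, Module.finrank ℂ (PmSub k d m) = d * Nat.choose (m + k - 1) m) ∧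
    (∀ m : ℕ, 2 ≤ m →
      Module.finrank ℂ (HmSub A m)
        = Module.finrank ℂ (PmSub k d m) - Module.finrank ℂ (PmSub k d (m - 2))) ∧
    Module.finrank ℂ (HmSub A 0) = Module.finrank ℂ (PmSub k d 0) ∧
    Module.finrank ℂ (HmSub A 1) = Module.finrank ℂ (PmSub k d 1) := by
  have j₀ : Fin k := ⟨0, by omega⟩
  refine ⟨finrank_PmSub k d, fun m hm => ?_, ?_, ?_⟩
  · obtain ⟨n, rfl⟩ := Nat.exists_eq_add_of_le' hm
    rw [← finrank_HmSub_add A j₀ (hinv j₀) n, Nat.add_sub_cancel, Nat.add_sub_cancel_left]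
  · rw [HmSub_eq_PmSub A zero_le_one]
  · rw [HmSub_eq_PmSub A le_rfl]

end
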